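/- arXiv:2507.15667 — 2 statements merged into one kernel-verified Lean document; each statement's English description precedes it below -/
import Mathlib

section
/- Let D=(V,A) be a strong semicomplete multipartite digraph and let x, y ∈ V be distinct vertices such that D−x and D−y are strong. If D−{x,y} is not strong, then D contains an (x,y)-quasi-Hamiltonian path. -/
open Set

variable {V : Type*}

/-- `p` is a directed path (nonempty, vertices pairwise distinct, consecutive
vertices joined by arcs of `A`) all of whose vertices lie in `S`. -/
def IsPathOn (A : V → V → Prop) (S : Set V) (p : List V) : Prop :=
  p ≠ [] ∧ p.Nodup ∧ p.Chain' A ∧ ∀ v ∈ p, v ∈ S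

/-- `p` is a directed path within `S` starting at `x` and ending at `y`. -/
def IsPathFromTo (A : V → V → Prop) (S : Set V) (p : List V) (x y : V) : Prop :=
  IsPathOn A S p ∧ p.head? = some x ∧ p.getLast? = some y

/-- The subdigraph induced on `S` is strong. -/
def StrongOn (A : V → V → Prop) (S : Set V) : Prop :=
  ∀ x ∈ S, ∀ y ∈ S, x ≠ y → ∃ p, IsPathFromTo A S p x y

/-- The subdigraph induced on `S` is `k`-strong: it has at least `k+1` vertices and
remains strong after deleting any set of at most `k-1` vertices. -/
def KStrongOn (A : V → V → Prop) (k : ℕ) (S : Set V) : Prop :=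
  k + 1 ≤ S.ncard ∧ ∀ X : Set V, X ⊆ S → X.ncard ≤ k - 1 → StrongOn A (S \ X)

/-- In a semicomplete multipartite digraph, two vertices lie in the same color class
iff they are equal or there is no arc between them in either direction. -/
def SameClass (A : V → V → Prop) (u v : V) : Prop :=
  u = v ∨ (¬ A u v ∧ ¬ A v u)

/-- `A` is (the arc relation of) a semicomplete multipartite digraph: it is loopless
and the "same color class" relation is transitive (hence an equivalence relation whose
classes are the color classes: within a class there are no arcs, and between any two
vertices of different classes there is at least one arc). -/
def IsSMD (A : V → V → Prop) : Prop :=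
  (∀ v, ¬ A v v) ∧
  ∀ u v w, SameClass A u v → SameClass A v w → SameClass A u w

/-- A digraph is unilaterally connected if any two distinct vertices are joined by a
directed path in one direction or the other. -/
def Unilateral (A : V → V → Prop) : Prop :=
  ∀ x y : V, x ≠ y →
    (∃ p, IsPathFromTo A Set.univ p x y) ∨ (∃ p, IsPathFromTo A Set.univ p y x)

/-- The independence number of a semicomplete multipartite digraph: the maximum size
of a color class. -/
noncomputable def indepNum [Fintype V] (A : V → V → Prop) : ℕ :=
  Finset.univ.sup fun v : V => {u | SameClass A v u}.ncard

/-- `X` is a 2-separator of `x` and `y`: at most two vertices, avoiding `x` and `y`,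
whose removal destroys all `(x,y)`-paths. -/
def IsTwoSep (A : V → V → Prop) (x y : V) (X : Set V) : Prop :=
  X ⊆ ({x, y} : Set V)ᶜ ∧ X.ncard ≤ 2 ∧ ¬ ∃ p, IsPathFromTo A Xᶜ p x y

/-- A separator of `x` and `y` is trivial if it contains all out-neighbors of `x`
or all in-neighbors of `y`. -/
def IsTrivialSep (A : V → V → Prop) (x y : V) (X : Set V) : Prop :=
  {w | A x w} ⊆ X ∨ {w | A w y} ⊆ X

/-- `T` is a strong component of the subdigraph induced on `S`: a maximal subset of
`S` inducing a strong subdigraph. -/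
def IsStrongComponentOn (A : V → V → Prop) (S T : Set V) : Prop :=
  T ⊆ S ∧ StrongOn A T ∧ ∀ U : Set V, T ⊆ U → U ⊆ S → StrongOn A U → U = T

/-- `R 0, …, R (k-1)` is the linear decomposition of the subdigraph induced on `S`:
an ordered partition of `S` into nonempty sets, each of which is a strong component
of the subdigraph induced on `S` or a subset of a single color class, with no arc
from a later part to an earlier one and at least one arc between consecutive parts. -/
def IsLinearDecompOn (A : V → V → Prop) (S : Set V) (k : ℕ) (R : Fin k → Set V) : Prop :=
  (∀ i, (R i).Nonempty ∧ R i ⊆ S) ∧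
  (∀ v ∈ S, ∃! i, v ∈ R i) ∧
  (∀ i, IsStrongComponentOn A S (R i) ∨ ∃ v, R i ⊆ {u | SameClass A v u}) ∧
  (∀ i j : Fin k, i < j → ∀ a ∈ R j, ∀ b ∈ R i, ¬ A a b) ∧
  (∀ i : Fin k, ∀ h : (i : ℕ) + 1 < k, ∃ a ∈ R i, ∃ b ∈ R ⟨(i : ℕ) + 1, h⟩, A a b)

/-- The digraph with arc relation `B` contains a directed cycle. -/
def HasCycle (B : V → V → Prop) : Prop :=
  ∃ c : List V, 2 ≤ c.length ∧ c.Nodup ∧ c.Chain' B ∧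
    ∃ a b, c.head? = some a ∧ c.getLast? = some b ∧ B b a

section Helpers

open Relation Function

variable {W : Type*} {B : W → W → Prop}

theorem IsPathFromTo.reverse {S : Set W} {l : List W} {a b : W} (h : IsPathFromTo B S l a b) :
    IsPathFromTo (swap B) S l.reverse b a := by
  obtain ⟨⟨hne, hnd, hc, hS⟩, ha, hb⟩ := h
  refine ⟨⟨by simpa using hne, List.nodup_reverse.2 hnd, ?_, by simpa using hS⟩, by simpa using hb,
    by simpa using ha⟩
  exact List.isChain_reverse.2 hc

theorem IsSMD.comap {V : Type*} {A : V → V → Prop} (h : IsSMD A) (f : W ↪ V) :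
    IsSMD (fun u w => A (f u) (f w)) := by
  refine ⟨fun v => h.1 _, fun u v w huv hvw => ?_⟩
  have := h.2 (f u) (f v) (f w)
  simp only [SameClass, f.injective.eq_iff] at *
  exact this huv hvw

/-- A reachable vertex is reached by a path. -/
theorem exists_isPathFromTo_of_reflTransGen {a b : W} (h : ReflTransGen B a b) :
    ∃ l, IsPathFromTo B univ l a b := by
  classical
  induction h using ReflTransGen.head_induction_on with
  | refl => exact ⟨[b], ⟨by simp, by simp, List.isChain_singleton b, by simp⟩, rfl, rfl⟩
  | @head a c hac _ ih =>
    obtain ⟨l, ⟨hne, hnd, hc, -⟩, hhead, hlast⟩ := ih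
    by_cases hal : a ∈ l
    · obtain ⟨s, t, rfl⟩ := List.append_of_mem hal
      exact ⟨a :: t, ⟨by simp, hnd.of_append_right, (List.isChain_append.1 hc).2.1, by simp⟩, rfl,
        by simpa using hlast⟩
    · refine ⟨a :: l, ⟨by simp, List.nodup_cons.2 ⟨hal, hnd⟩, ?_, by simp⟩, rfl, ?_⟩
      · refine List.isChain_cons.2 ⟨fun z hz => ?_, hc⟩
        rw [hhead] at hz
        cases hz
        exact hac
      · simp [List.getLast?_cons, hlast]

theorem reflTransGen_of_isChain {l : List W} {a b : W} (hc : l.IsChain B)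
    (ha : l.head? = some a) (hb : l.getLast? = some b) : ReflTransGen B a b := by
  cases l with
  | nil => simp at ha
  | cons c t =>
    obtain rfl : c = a := by simpa using ha
    refine List.relationReflTransGen_of_exists_isChain_cons t hc ?_
    rw [List.getLast?_eq_some_getLast (by simp)] at hb
    exact Option.some.inj hb

/-- Cutting a list that meets `P` after its last element in `P`. -/
theorem exists_last_mem_split (P : W → Prop) (l : List W) (h : ∃ u ∈ l, P u) :
    ∃ s q t, l = s ++ q :: t ∧ P q ∧ ∀ u ∈ t, ¬ P u := by
  induction l with
  | nil => simp at h
  | cons c l ih =>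
    by_cases hl : ∃ u ∈ l, P u
    · obtain ⟨s, q, t, rfl, hq, ht⟩ := ih hl
      exact ⟨c :: s, q, t, rfl, hq, ht⟩
    · push Not at hl
      refine ⟨[], c, l, rfl, ?_, hl⟩
      obtain ⟨u, hu, hPu⟩ := h
      rcases List.mem_cons.1 hu with rfl | hu
      · exact hPu
      · exact absurd hPu (hl u hu)

/-- If `v` dominates a path but is reachable from its start, the path can be detoured through `v`. -/
theorem IsPathFromTo.exists_longer_of_dominating {l : List W} {a b v : W}
    (h : IsPathFromTo B univ l a b) (hv : v ∉ l) (hdom : ∀ u ∈ l, B v u)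
    (hav : ReflTransGen B a v) (hba : ¬ ReflTransGen B b a) :
    ∃ l', IsPathFromTo B univ l' a b ∧ l.length < l'.length := by
  obtain ⟨⟨hne, hnd, hc, -⟩, ha, hb⟩ := h
  obtain ⟨Q, ⟨-, hQnd, hQc, -⟩, hQa, hQv⟩ := exists_isPathFromTo_of_reflTransGen hav
  have hal : a ∈ l := List.mem_of_mem_head? ha
  obtain ⟨s, q, t, rfl, hq, ht⟩ :=
    exists_last_mem_split (· ∈ l) Q ⟨a, List.mem_of_mem_head? hQa, hal⟩
  obtain ⟨P₁, P₂, rfl⟩ := List.append_of_mem hq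
  have hchain : (q :: t).IsChain B := (List.isChain_append.1 hQc).2.1
  have hlast : (q :: t).getLast? = some v := by simpa using hQv
  have htne : t ≠ [] := by
    rintro rfl
    obtain rfl : q = v := by simpa using hlast
    exact hv hq
  have hP₂ : P₂ ≠ [] := by
    rintro rfl
    obtain rfl : q = b := by simpa using hb
    exact hba ((reflTransGen_of_isChain hchain rfl hlast).tail (hdom a hal))
  refine ⟨P₁ ++ q :: (t ++ P₂), ⟨⟨by simp, ?_, ?_, by simp⟩, ?_, ?_⟩, ?_⟩
  · have htnd : (q :: t).Nodup := hQnd.of_append_right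
    grind [List.nodup_append, List.nodup_cons]
  · have h1 := List.isChain_split.1 hc
    refine List.isChain_split.2 ⟨h1.1, ?_⟩
    rw [← List.cons_append]
    refine List.isChain_append.2 ⟨hchain, h1.2.tail, fun z hz w hw => ?_⟩
    rw [hlast] at hz
    cases hz
    exact hdom w (by simp [List.mem_of_mem_head? hw])
  · cases P₁ <;> simpa using ha
  · have hb' : P₂.getLast? = some b := by
      obtain ⟨c, P, rfl⟩ := List.exists_cons_of_ne_nil hP₂
      simpa using hb
    simp [List.getLast?_append, List.getLast?_cons, hb']
  · have := List.length_pos_iff.2 htne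
    simp only [List.length_append, List.length_cons]
    omega

/-- A vertex adjacent to all of a path can be inserted into it, unless it dominates an initial
segment and is dominated by the rest. -/
theorem exists_insert_or_split {l : List W} {v : W} (hc : l.IsChain B)
    (hadj : ∀ u ∈ l, B u v ∨ B v u) :
    (∃ s t, s ≠ [] ∧ t ≠ [] ∧ l = s ++ t ∧ (s ++ v :: t).IsChain B) ∨
      ∃ s t, l = s ++ t ∧ (∀ u ∈ s, B v u) ∧ ∀ u ∈ t, B u v := by
  induction l with
  | nil => exact .inr ⟨[], [], by simp⟩
  | cons c l ih =>
    rcases ih hc.tail (fun u hu => hadj u (by simp [hu])) with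
      ⟨s, t, hs, ht, rfl, hst⟩ | ⟨s, t, rfl, hs, ht⟩
    · refine .inl ⟨c :: s, t, by simp, ht, rfl, ?_⟩
      obtain ⟨d, s, rfl⟩ := List.exists_cons_of_ne_nil hs
      exact List.isChain_cons_cons.2 ⟨(List.isChain_cons_cons.1 hc).1, hst⟩
    · by_cases hvc : B v c
      · exact .inr ⟨c :: s, t, rfl, by simpa using ⟨hvc, hs⟩, ht⟩
      have hcv : B c v := (hadj c (by simp)).resolve_right hvc
      cases s with
      | nil => exact .inr ⟨[], c :: t, rfl, by simp, by simpa using ⟨hcv, ht⟩⟩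
      | cons d s =>
        refine .inl ⟨[c], d :: (s ++ t), by simp, by simp, rfl, ?_⟩
        exact List.isChain_cons_cons.2 ⟨hcv, List.isChain_cons_cons.2 ⟨hs d (by simp), hc.tail⟩⟩

/-- A path between an initial and a terminal strong component which misses a color class can be
lengthened. -/
theorem IsPathFromTo.exists_longer {l : List W} {a b v : W}
    (h : IsPathFromTo B univ l a b) (hba : ¬ ReflTransGen B b a)
    (ha : ∀ v, ReflTransGen B v a → ReflTransGen B a v)
    (hb : ∀ v, ReflTransGen B b v → ReflTransGen B v b)
    (hv : ∀ u ∈ l, ¬ SameClass B u v) :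
    ∃ l', IsPathFromTo B univ l' a b ∧ l.length < l'.length := by
  have hvl : v ∉ l := fun hvl => hv v hvl (.inl rfl)
  have hadj : ∀ u ∈ l, B u v ∨ B v u := fun u hu => by
    have := hv u hu
    simp only [SameClass] at this
    tauto
  have h' := h
  obtain ⟨⟨hne, hnd, hc, -⟩, hla, hlb⟩ := h
  rcases exists_insert_or_split hc hadj with ⟨s, t, hs, ht, rfl, hst⟩ | ⟨s, t, rfl, hs, ht⟩
  · refine ⟨s ++ v :: t, ⟨⟨by simp, ?_, hst, by simp⟩, ?_, ?_⟩, by simp⟩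
    · grind [List.nodup_append, List.nodup_cons]
    · obtain ⟨d, s, rfl⟩ := List.exists_cons_of_ne_nil hs
      simpa using hla
    · obtain ⟨d, t, rfl⟩ := List.exists_cons_of_ne_nil ht
      simpa using hlb
  · rcases List.eq_nil_or_concat t with rfl | ⟨t, c, rfl⟩
    · rw [List.append_nil] at *
      have hva : B v a := hs a (List.mem_of_mem_head? hla)
      exact h'.exists_longer_of_dominating hvl hs (ha v (.single hva)) hba
    obtain rfl : c = b := by simpa [← List.append_assoc] using hlb
    have hcv : B c v := ht c (by simp)
    cases s with
    | nil =>
      rw [List.nil_append] at *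
      have hvc := hb v (.single hcv)
      obtain ⟨l', hl', hlen⟩ := h'.reverse.exists_longer_of_dominating
        (v := v) (by rwa [List.mem_reverse]) (fun u hu => ht u (List.mem_reverse.1 hu))
        (reflTransGen_swap.2 hvc) (fun hac => hba (reflTransGen_swap.1 hac))
      exact ⟨l'.reverse, hl'.reverse, by simpa using hlen⟩
    | cons d s =>
      obtain rfl : d = a := by simpa using hla
      exact absurd (ReflTransGen.head hcv (.single (hs d (by simp)))) hba

theorem exists_quasiHamiltonian_path [Fintype W] {a b : W} (hab : ReflTransGen B a b)
    (hba : ¬ ReflTransGen B b a)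
    (ha : ∀ v, ReflTransGen B v a → ReflTransGen B a v)
    (hb : ∀ v, ReflTransGen B b v → ReflTransGen B v b) :
    ∃ l, IsPathFromTo B univ l a b ∧ ∀ v, ∃ u ∈ l, SameClass B u v := by
  by_contra! hcon
  have key : ∀ n : ℕ, ∃ l, IsPathFromTo B univ l a b ∧ n ≤ l.length := by
    intro n
    induction n with
    | zero => simpa using exists_isPathFromTo_of_reflTransGen hab
    | succ n ih =>
      obtain ⟨l, hl, hn⟩ := ih
      obtain ⟨v, hv⟩ := hcon l hl
      obtain ⟨l', hl', hlen⟩ := hl.exists_longer hba ha hb hv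
      exact ⟨l', hl', by omega⟩
  obtain ⟨l, hl, hlen⟩ := key (Fintype.card W + 1)
  have := hl.1.2.1.length_le_card
  omega

theorem exists_initial [Finite W] (B : W → W → Prop) (w : W) :
    ∃ a, ReflTransGen B a w ∧ ∀ v, ReflTransGen B v a → ReflTransGen B a v := by
  let r : W → W → Prop := fun u v => ReflTransGen B u v ∧ ¬ ReflTransGen B v u
  have : IsTrans W r :=
    ⟨fun _ _ _ h₁ h₂ => ⟨h₁.1.trans h₂.1, fun h => h₂.2 (h.trans h₁.1)⟩⟩
  have : Std.Irrefl r := ⟨fun _ h => h.2 h.1⟩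
  obtain ⟨a, haw, hmin⟩ :=
    (Finite.wellFounded_of_trans_of_irrefl r).has_min {a | ReflTransGen B a w} ⟨w, .refl⟩
  refine ⟨a, haw, fun v hv => ?_⟩
  by_contra hav
  exact hmin v (ReflTransGen.trans hv haw) ⟨hv, hav⟩

theorem exists_terminal [Finite W] (B : W → W → Prop) (w : W) :
    ∃ b, ReflTransGen B w b ∧ ∀ v, ReflTransGen B b v → ReflTransGen B v b := by
  simpa only [reflTransGen_swap] using exists_initial (swap B) w

/-- In a semicomplete multipartite digraph, an initial vertex reaches a terminal one, unless the
whole digraph is a single color class. -/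
theorem IsSMD.reflTransGen_or_forall_sameClass (h : IsSMD B) {a b : W}
    (hba : ¬ ReflTransGen B b a)
    (ha : ∀ v, ReflTransGen B v a → ReflTransGen B a v)
    (hb : ∀ v, ReflTransGen B b v → ReflTransGen B v b) :
    ReflTransGen B a b ∨ ∀ v, SameClass B a v := by
  by_contra! hcon
  obtain ⟨hab, c, hc⟩ := hcon
  have hab' : SameClass B a b := .inr ⟨fun h => hab (.single h), fun h => hba (.single h)⟩
  have hbc : ¬ SameClass B b c := fun hbc => hc (h.2 _ _ _ hab' hbc)
  simp only [SameClass, not_or, not_and_or, not_not] at hc hbc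
  have hac : ReflTransGen B a c := hc.2.elim .single fun h => ha c (.single h)
  have hcb : ReflTransGen B c b := hbc.2.elim (fun h => hb c (.single h)) .single
  exact hab (hac.trans hcb)

/-- A path from outside `S` which otherwise stays in `S` enters `S` at an out-neighbor of its
start, from which its end is reachable within `S`. -/
theorem IsPathFromTo.exists_entry {V : Type*} {A : V → V → Prop} {S T : Set V} {l : List V} {x : V}
    {c : S} (h : IsPathFromTo A T l x c) (hT : T ⊆ insert x S) (hx : x ∉ S) :
    ∃ a : S, A x a ∧ ReflTransGen (fun u w : S => A u w) a c := by
  obtain ⟨⟨-, hnd, hc, hlT⟩, hlx, hlc⟩ := h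
  cases l with
  | nil => simp at hlx
  | cons d t =>
    obtain rfl : d = x := by simpa using hlx
    cases t with
    | nil =>
      obtain rfl : d = c := by simpa using hlc
      exact absurd c.2 hx
    | cons a t =>
      have hS : ∀ u ∈ a :: t, u ∈ S := fun u hu => by
        refine (hT (hlT u (List.mem_cons_of_mem _ hu))).resolve_left ?_
        rintro rfl
        exact (List.nodup_cons.1 hnd).1 hu
      obtain ⟨t', ht'⟩ : ∃ t' : List S, t'.map (↑) = a :: t :=
        ⟨(a :: t).attachWith (· ∈ S) hS, by simp⟩
      have hc' : t'.IsChain (fun u w : S => A u w) := by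
        rw [← List.isChain_map, ht']
        exact hc.tail
      refine ⟨⟨a, hS a (by simp)⟩, (List.isChain_cons_cons.1 hc).1,
        reflTransGen_of_isChain hc' ?_ ?_⟩
      · have := congrArg List.head? ht'
        cases t' with
        | nil => simp at ht'
        | cons e t' => simp at ht'; simp [← ht'.1]
      · have : (t'.map ((↑) : S → V)).getLast? = some (c : V) := by
          rw [ht']
          simpa using hlc
        rw [List.getLast?_map] at this
        exact Option.map_injective Subtype.val_injective this

theorem IsPathFromTo.map_val {V : Type*} {A : V → V → Prop} {S : Set V} {l : List S} {a b : S}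
    (h : IsPathFromTo (fun u w : S => A u w) univ l a b) :
    IsPathFromTo A S (l.map (↑)) a b := by
  obtain ⟨⟨hne, hnd, hc, -⟩, ha, hb⟩ := h
  refine ⟨⟨by simpa only [ne_eq, List.map_eq_nil_iff] using hne, hnd.map Subtype.val_injective, (List.isChain_map _).2 hc, ?_⟩, ?_, ?_⟩
  · intro v hv
    obtain ⟨u, -, rfl⟩ := List.mem_map.1 hv
    exact u.2
  · rw [List.head?_map, ha]
    rfl
  · rw [List.getLast?_map, hb]
    rfl

theorem IsPathFromTo.extend {V : Type*} {A : V → V → Prop} {x y a b : V} {l : List V}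
    (h : IsPathFromTo A {x, y}ᶜ l a b) (hxy : x ≠ y) (hxa : A x a) (hby : A b y) :
    IsPathFromTo A univ (x :: l ++ [y]) x y := by
  obtain ⟨⟨hne, hnd, hc, hS⟩, hla, hlb⟩ := h
  have hxl : x ∉ l := fun hx => hS x hx (by simp)
  have hyl : y ∉ l := fun hy => hS y hy (by simp)
  refine ⟨⟨by simp, ?_, ?_, by simp⟩, by simp, List.getLast?_concat⟩
  · grind [List.nodup_append, List.nodup_cons]
  · rw [List.cons_append]
    refine List.isChain_cons.2 ⟨fun z hz => ?_, List.isChain_append.2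
      ⟨hc, List.isChain_singleton y, fun z hz w hw => ?_⟩⟩
    · obtain rfl : z = a := by
        rw [List.head?_append, hla] at hz
        simpa using hz.symm
      exact hxa
    · rw [hlb] at hz
      cases hz
      obtain rfl : y = w := by simpa using hw
      exact hby

end Helpers

/-- Let `D` be a strong SMD and `x ≠ y` vertices such that `D-x` and
`D-y` are strong. If `D-{x,y}` is not strong, then `D` contains an
`(x,y)`-quasi-Hamiltonian path. -/
theorem stmt_14 {V : Type*} [Fintype V] (A : V → V → Prop) (hSMD : IsSMD A)
    (hstrong : StrongOn A (Set.univ : Set V))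
    (x y : V) (hxy : x ≠ y)
    (hDx : StrongOn A ({x}ᶜ : Set V)) (hDy : StrongOn A ({y}ᶜ : Set V))
    (hDxy : ¬ StrongOn A (({x, y} : Set V)ᶜ)) :
    ∃ p : List V, IsPathFromTo A Set.univ p x y ∧
      ∀ v : V, ∃ u ∈ p, SameClass A u v := by
  classical
  let S : Set V := {x, y}ᶜ
  let B : S → S → Prop := fun u w => A u w
  have hB : IsSMD B := hSMD.comap (Function.Embedding.subtype S)
  obtain ⟨u, w, huw⟩ : ∃ u w : S, ¬ Relation.ReflTransGen B u w := by
    by_contra! hcon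
    refine hDxy fun u hu w hw _ => ?_
    obtain ⟨l, hl⟩ := exists_isPathFromTo_of_reflTransGen (hcon ⟨u, hu⟩ ⟨w, hw⟩)
    exact ⟨_, hl.map_val⟩
  obtain ⟨a₀, ha₀w, ha₀⟩ := exists_initial B w
  obtain ⟨b₀, hub₀, hb₀⟩ := exists_terminal B u
  have hba₀ : ¬ Relation.ReflTransGen B b₀ a₀ := fun h => huw ((hub₀.trans h).trans ha₀w)
  have hxS : x ∉ S := by simp [S]
  have hyS : y ∉ S := by simp [S]
  have hne : ∀ c : S, x ≠ c ∧ y ≠ c := fun c =>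
    ⟨fun h => hxS (h ▸ c.2), fun h => hyS (h ▸ c.2)⟩
  have entry : ∀ c : S, ∃ a : S, A x a ∧ Relation.ReflTransGen B a c := fun c => by
    obtain ⟨l, hl⟩ := hDy x (by simpa using hxy) c (by simpa using (hne c).2.symm) (hne c).1
    refine hl.exists_entry (fun z hz => ?_) hxS
    have : z ≠ y := hz
    by_cases hzx : z = x <;> simp [S, *]
  have departure : ∀ c : S, ∃ b : S, A b y ∧ Relation.ReflTransGen B c b := fun c => by
    obtain ⟨l, hl⟩ := hDx c (by simpa using (hne c).1.symm) y (by simpa using hxy.symm)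
      (hne c).2.symm
    obtain ⟨b, hby, hb⟩ := hl.reverse.exists_entry (fun z hz => by
      have : z ≠ x := hz
      by_cases hzy : z = y <;> simp [S, *]) hyS
    exact ⟨b, hby, Relation.reflTransGen_swap.1 hb⟩
  suffices ∃ (a b : S) (l : List S), A x a ∧ A b y ∧ IsPathFromTo B univ l a b ∧
      ∀ v, ∃ u ∈ l, SameClass B u v by
    obtain ⟨a, b, l, hxa, hby, hl, hcov⟩ := this
    refine ⟨_, hl.map_val.extend hxy hxa hby, fun v => ?_⟩
    by_cases hv : v ∈ S
    · obtain ⟨u, hu, huv⟩ := hcov ⟨v, hv⟩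
      refine ⟨u, by simp [hu], ?_⟩
      simpa [SameClass, B, Subtype.ext_iff] using huv
    · have : v = x ∨ v = y := by simpa [S, or_iff_not_imp_left] using hv
      exact ⟨v, by rcases this with rfl | rfl <;> simp, .inl rfl⟩
  obtain ⟨a, hxa, haa₀⟩ := entry a₀
  rcases hB.reflTransGen_or_forall_sameClass hba₀ ha₀ hb₀ with hab₀ | hclass
  · obtain ⟨b, hby, hb₀b⟩ := departure b₀
    obtain ⟨l, hl, hcov⟩ := exists_quasiHamiltonian_path ((haa₀.trans hab₀).trans hb₀b)
      (fun h => hba₀ ((hb₀b.trans h).trans haa₀))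
      (fun v hv => haa₀.trans (ha₀ v (hv.trans haa₀)))
      (fun v hv => (hb₀ v (hb₀b.trans hv)).trans hb₀b)
    exact ⟨a, b, l, hxa, hby, hl, hcov⟩
  · have hsymm : ∀ {c d : S}, SameClass B c d → SameClass B d c := fun h =>
      h.imp Eq.symm And.symm
    have hno : ∀ c d : S, ¬ B c d := fun c d h => by
      rcases hB.2 _ _ _ (hsymm (hclass c)) (hclass d) with rfl | h'
      · exact hB.1 c h
      · exact h'.1 h
    obtain ⟨b, hby, hab⟩ := departure a
    obtain rfl : a = b := by
      rcases hab.cases_head with h | ⟨c, hc, -⟩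
      · exact h
      · exact absurd hc (hno _ _)
    exact ⟨a, a, [a], hxa, hby,
      ⟨⟨by simp, by simp, List.isChain_singleton a, by simp⟩, rfl, rfl⟩,
      fun v => ⟨a, by simp, .inr ⟨hno _ _, hno _ _⟩⟩⟩
end

section
/- Let D be a strong semicomplete multipartite digraph and let u, v, w be three distinct vertices of D. Then there exist two distinct vertices a, b ∈ {u, v, w} such that D contains a quasi-Hamiltonian path whose endpoints are a and b. -/
open Set

variable {V : Type*}

section SameClass

variable {A : V → V → Prop} {a b c : V}

lemma SameClass.refl (A : V → V → Prop) (a : V) : SameClass A a a := Or.inl rfl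

lemma SameClass.symm (h : SameClass A a b) : SameClass A b a :=
  h.imp Eq.symm And.symm

lemma SameClass.trans (hA : IsSMD A) (h : SameClass A a b) (h' : SameClass A b c) :
    SameClass A a c :=
  hA.2 _ _ _ h h'

lemma adj_of_not_sameClass (h : ¬ SameClass A a b) : A a b ∨ A b a := by
  unfold SameClass at h
  tauto

lemma IsSMD.not_sameClass (hA : IsSMD A) (h : A a b) : ¬ SameClass A a b := by
  rintro (rfl | h')
  · exact hA.1 _ h
  · exact h'.1 h

lemma IsSMD.not_sameClass' (hA : IsSMD A) (h : A a b) : ¬ SameClass A b a :=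
  fun h' => hA.not_sameClass h h'.symm

lemma sameClass_flip : SameClass (flip A) a b ↔ SameClass A a b := by
  simp only [SameClass, flip]
  tauto

lemma IsSMD.flip (hA : IsSMD A) : IsSMD (flip A) :=
  ⟨fun v => hA.1 v, fun u v w => by simpa only [sameClass_flip] using hA.2 u v w⟩

end SameClass

/-- The set of vertices whose color class is met by the list `p`. -/
def covered (A : V → V → Prop) (p : List V) : Set V := {t | ∃ s ∈ p, SameClass A s t}

section covered

variable {A : V → V → Prop} {p q : List V}

lemma mem_covered_of_mem {s : V} (h : s ∈ p) : s ∈ covered A p := ⟨s, h, .refl A s⟩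

lemma covered_mono (h : p ⊆ q) : covered A p ⊆ covered A q :=
  fun _ ⟨s, hs, hst⟩ => ⟨s, h hs, hst⟩

lemma adj_of_notMem_covered {s z : V} (hz : z ∉ covered A p) (hs : s ∈ p) : A s z ∨ A z s :=
  adj_of_not_sameClass fun h => hz ⟨s, hs, h⟩

lemma covered_flip_reverse : covered (flip A) p.reverse = covered A p := by
  ext t
  simp [covered, sameClass_flip]

/-- Among the lists with a given property there is one that no larger such list beats in terms
of the color classes that are met. -/
lemma exists_covered_maximal [Finite V] (A : V → V → Prop) (P : List V → Prop)
    (hP : ∃ p, P p) :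
    ∃ p, P p ∧ ∀ q, P q → p ⊆ q → ∀ z ∈ q, z ∈ covered A p := by
  obtain ⟨_, ⟨p, hp, rfl⟩, hmax⟩ :=
    (wellFounded_gt (α := Set V)).has_min (covered A '' {p | P p}) (Set.Nonempty.image _ hP)
  refine ⟨p, hp, fun q hq hpq z hz => ?_⟩
  by_contra hzp
  exact hmax _ ⟨q, hq, rfl⟩
    ((Set.ssubset_iff_of_subset (covered_mono hpq)).2 ⟨z, mem_covered_of_mem hz, hzp⟩)

end covered

/-- A vertex adjacent to all vertices of a chain and dominated by its head can be inserted
somewhere after the head. -/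
lemma exists_insert_chain {A : V → V → Prop} {z : V} (l : List V) (x : V) (hx : A x z)
    (hl : (x :: l).IsChain A) (hz : ∀ s ∈ l, A s z ∨ A z s) :
    ∃ l₁ l₂, l = l₁ ++ l₂ ∧ (x :: (l₁ ++ z :: l₂)).IsChain A := by
  induction l generalizing x with
  | nil => exact ⟨[], [], rfl, by simpa using hx⟩
  | cons y l ih =>
    rw [List.isChain_cons_cons] at hl
    by_cases hy : A y z
    · obtain ⟨l₁, l₂, rfl, h⟩ := ih y hy hl.2 fun s hs => hz s (by simp [hs])
      exact ⟨y :: l₁, l₂, rfl, List.isChain_cons_cons.2 ⟨hl.1, h⟩⟩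
    · have := (hz y (by simp)).resolve_left hy
      exact ⟨[], y :: l, rfl, by simp [hx, this, hl.2]⟩

/-- Reachability by directed walks within `T`. -/
def Reach (A : V → V → Prop) (T : Set V) : V → V → Prop :=
  Relation.ReflTransGen fun a b => A a b ∧ a ∈ T ∧ b ∈ T

section Reach

variable {A : V → V → Prop} {S T : Set V} {a b c : V} {p : List V}

lemma Reach.trans (h : Reach A T a b) (h' : Reach A T b c) : Reach A T a c :=
  Relation.ReflTransGen.trans h h'

lemma Reach.of_adj (h : A a b) (ha : a ∈ T) (hb : b ∈ T) : Reach A T a b :=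
  Relation.ReflTransGen.single ⟨h, ha, hb⟩

lemma reach_flip : Reach (flip A) T a b ↔ Reach A T b a := by
  rw [Reach, Reach, ← Relation.reflTransGen_swap]
  apply iff_of_eq
  congr 1
  ext x y
  simp only [flip, Function.swap]
  tauto

lemma IsPathFromTo.reach (h : IsPathFromTo A T p a b) : Reach A T a b := by
  obtain ⟨⟨-, -, hc, hT⟩, ha, hb⟩ := h
  induction p generalizing a with
  | nil => simp at ha
  | cons x l ih =>
    obtain rfl : x = a := by simpa using ha
    cases l with
    | nil =>
      obtain rfl : x = b := by simpa using hb
      exact .refl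
    | cons y l =>
      have hc' := List.isChain_cons_cons.1 hc
      exact .head ⟨hc'.1, hT _ (by simp), hT _ (by simp)⟩
        (ih hc'.2 (fun v hv => hT v (by simp [hv])) rfl (by simpa using hb))

lemma IsPathFromTo.mono (hST : S ⊆ T) (h : IsPathFromTo A S p a b) : IsPathFromTo A T p a b :=
  ⟨⟨h.1.1, h.1.2.1, h.1.2.2.1, fun v hv => hST (h.1.2.2.2 v hv)⟩, h.2⟩

lemma IsPathFromTo.append {q : List V} {d : V} (hp : IsPathFromTo A T p a c)
    (hq : IsPathFromTo A T q d b) (hpq : ∀ s ∈ p, s ∉ q) (hcd : A c d) :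
    IsPathFromTo A T (p ++ q) a b := by
  obtain ⟨⟨hpne, hpnd, hpc, hpT⟩, hpa, hpl⟩ := hp
  obtain ⟨⟨hqne, hqnd, hqc, hqT⟩, hqd, hql⟩ := hq
  refine ⟨⟨by simp [hpne], by grind, ?_, by grind⟩, ?_, ?_⟩
  · refine List.isChain_append.2 ⟨hpc, hqc, fun s hs t ht => ?_⟩
    grind
  · simp [List.head?_append, hpa]
  · simp [List.getLast?_append, hql]

lemma isPathFromTo_singleton (ha : a ∈ T) : IsPathFromTo A T [a] a a :=
  ⟨⟨by simp, by simp, List.isChain_singleton _, by simpa using ha⟩, rfl, rfl⟩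

lemma IsPathFromTo.cons (ha : a ∈ T) (hp : IsPathFromTo A T p b c) (hap : a ∉ p) (hab : A a b) :
    IsPathFromTo A T (a :: p) a c :=
  (isPathFromTo_singleton ha).append hp (by simpa using hap) hab

lemma Reach.exists_path (hb : b ∈ T) (h : Reach A T a b) : ∃ p, IsPathFromTo A T p a b := by
  induction h using Relation.ReflTransGen.head_induction_on with
  | refl => exact ⟨[b], ⟨by simp, by simp, List.isChain_singleton _, by simpa using hb⟩, rfl, rfl⟩
  | @head x y hxy _ ih =>
    obtain ⟨p, ⟨hne, hnd, hc, hT⟩, hy, hb⟩ := ih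
    by_cases hx : x ∈ p
    · obtain ⟨l₁, l₂, rfl⟩ := List.mem_iff_append.1 hx
      refine ⟨x :: l₂, ⟨by simp, (List.nodup_append.1 hnd).2.1, (List.isChain_append.1 hc).2.1,
        fun v hv => hT v (List.mem_append_right _ hv)⟩, rfl, ?_⟩
      simpa [List.getLast?_append] using hb
    · refine ⟨x :: p, ⟨by simp, by simp [hx, hnd], ?_, ?_⟩, rfl, ?_⟩
      · refine List.isChain_cons.2 ⟨fun z hz => ?_, hc⟩
        obtain rfl : y = z := by simpa [hy] using hz
        exact hxy.1
      · simpa using ⟨hxy.2.1, hT⟩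
      · simp [List.getLast?_cons, hb]

/-- A walk leaving `P` has a last arc out of `P`. -/
lemma Reach.exists_exit {P : Set V} (h : Reach A T a b) (ha : a ∈ P) (hb : b ∉ P) :
    ∃ x ∈ P, ∃ y ∈ T \ P, x ∈ T ∧ A x y ∧ Reach A (T \ P) y b := by
  induction h with
  | refl => exact absurd ha hb
  | @tail c b _ hcb ih =>
    by_cases hc : c ∈ P
    · exact ⟨c, hc, b, ⟨hcb.2.2, hb⟩, hcb.2.1, hcb.1, .refl⟩
    · obtain ⟨x, hx, y, hy, hxT, hxy, h⟩ := ih hc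
      exact ⟨x, hx, y, hy, hxT, hxy,
        Relation.ReflTransGen.tail h ⟨hcb.1, ⟨hcb.2.1, hc⟩, hcb.2.2, hb⟩⟩

/-- A walk leaving `P` yields a path outside `P` entered by an arc from `P`. -/
lemma Reach.exists_exit_path {P : Set V} (h : Reach A T a b) (ha : a ∈ P) (hb : b ∉ P)
    (hbT : b ∈ T) : ∃ x ∈ P, ∃ y p, IsPathFromTo A (T \ P) p y b ∧ A x y := by
  obtain ⟨x, hx, y, -, -, hxy, h⟩ := h.exists_exit ha hb
  obtain ⟨p, hp⟩ := Reach.exists_path (T := T \ P) ⟨hbT, hb⟩ h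
  exact ⟨x, hx, y, p, hp, hxy⟩

lemma isPathOn_flip_reverse : IsPathOn (flip A) T p.reverse ↔ IsPathOn A T p := by
  simp only [IsPathOn, ne_eq, List.reverse_eq_nil_iff, List.nodup_reverse, List.mem_reverse]
  refine and_congr_right fun _ => and_congr_right fun _ => and_congr_left fun _ => ?_
  exact List.isChain_reverse

lemma isPathFromTo_flip_reverse :
    IsPathFromTo (flip A) T p.reverse a b ↔ IsPathFromTo A T p b a := by
  simp only [IsPathFromTo, isPathOn_flip_reverse, List.head?_reverse, List.getLast?_reverse]
  tauto

/-- A walk entering `P` yields a path outside `P` left by an arc to `P`. -/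
lemma Reach.exists_entry_path {P : Set V} (h : Reach A T a b) (ha : a ∉ P) (hb : b ∈ P)
    (haT : a ∈ T) : ∃ x ∈ P, ∃ y p, IsPathFromTo A (T \ P) p a y ∧ A y x := by
  obtain ⟨x, hx, y, p, hp, hxy⟩ := (reach_flip.2 h).exists_exit_path hb ha haT
  exact ⟨x, hx, y, p.reverse, isPathFromTo_flip_reverse.1 (by simpa using hp), hxy⟩

end Reach

section QuasiHamiltonian

variable {A : V → V → Prop} {S T : Set V} {a b u v w x : V}

/-- There is an `(a, b)`-path within `S` meeting the color class of every vertex of `S`. -/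
def HasQHPath (A : V → V → Prop) (S : Set V) (a b : V) : Prop :=
  ∃ p, IsPathFromTo A S p a b ∧ S ⊆ covered A p

lemma hasQHPath_flip : HasQHPath (flip A) S a b ↔ HasQHPath A S b a := by
  constructor
  · rintro ⟨p, hp, hS⟩
    refine ⟨p.reverse, isPathFromTo_flip_reverse.1 (by simpa using hp), ?_⟩
    rwa [← covered_flip_reverse, List.reverse_reverse]
  · rintro ⟨p, hp, hS⟩
    exact ⟨p.reverse, isPathFromTo_flip_reverse.2 hp, by rwa [covered_flip_reverse]⟩

/-- A vertex reaching all of `S` starts a path meeting all color classes of `S`. -/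
lemma exists_path_from [Finite V] (hx : x ∈ S) (h : ∀ t ∈ S, Reach A S x t) :
    ∃ b, HasQHPath A S x b := by
  obtain ⟨p, ⟨⟨hne, hnd, hc, hpS⟩, hpx⟩, hmax⟩ := exists_covered_maximal A
    (fun p => IsPathOn A S p ∧ p.head? = some x)
    ⟨[x], ⟨by simp, by simp, List.isChain_singleton _, by simpa using hx⟩, rfl⟩
  refine ⟨p.getLast hne, p, ⟨⟨hne, hnd, hc, hpS⟩, hpx, List.getLast?_eq_some_getLast hne⟩,
    fun z hz => ?_⟩
  by_contra hzp
  have hzp' : z ∉ p := fun h => hzp (mem_covered_of_mem h)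
  have hzout : ∀ s ∈ p, ¬ A s z := by
    intro s hs hsz
    obtain ⟨l, m, rfl⟩ := List.mem_iff_append.1 hs
    obtain ⟨m₁, m₂, rfl, hm⟩ := exists_insert_chain m s hsz (List.isChain_append.1 hc).2.1
      fun t ht => adj_of_notMem_covered hzp (by simp [ht])
    refine hzp (hmax (l ++ s :: (m₁ ++ z :: m₂)) ⟨⟨by simp, ?_, ?_, ?_⟩, ?_⟩ ?_ z (by simp))
    · grind
    · rw [List.Chain', List.isChain_append] at *
      exact ⟨hc.1, hm, by simpa using hc.2.2⟩
    · grind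
    · cases l <;> simpa using hpx
    · grind
  have hxp : x ∈ p := List.mem_of_head? hpx
  obtain ⟨s, hs, y, l, ⟨⟨hlne, hlnd, hlc, hlS⟩, hly, hlz⟩, hsy⟩ :=
    (h z hz).exists_exit_path (P := {t | t ∈ p}) hxp hzp' hz
  obtain ⟨p₁, p₂, rfl⟩ := List.mem_iff_append.1 hs
  have hzl : z ∈ l := List.mem_of_getLast? hlz
  have hzall : ∀ t ∈ p₁ ++ s :: p₂, A z t := fun t ht =>
    (adj_of_notMem_covered hzp ht).resolve_left (hzout t ht)
  refine hzp (hmax (p₁ ++ s :: (l ++ p₂)) ⟨⟨by simp, ?_, ?_, ?_⟩, ?_⟩ ?_ z (by simp [hzl]))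
  · grind
  · have h₁ := List.isChain_append.1 hc
    have h₂ := List.isChain_cons.1 h₁.2.1
    refine List.isChain_append.2 ⟨h₁.1, List.isChain_cons.2 ⟨?_, ?_⟩, by simpa using h₁.2.2⟩
    · intro y' hy'
      grind
    · refine List.isChain_append.2 ⟨hlc, h₂.2, fun z' hz' t ht => ?_⟩
      obtain rfl : z = z' := by simpa [hlz] using hz'
      exact hzall t (by simp [List.mem_of_head? ht])
  · grind
  · cases p₁ <;> simpa using hpx
  · grind

lemma exists_path_to [Finite V] (hx : x ∈ S) (h : ∀ t ∈ S, Reach A S t x) :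
    ∃ a, HasQHPath A S a x := by
  obtain ⟨b, hb⟩ := exists_path_from (A := flip A) hx fun t ht => reach_flip.2 (h t ht)
  exact ⟨b, hasQHPath_flip.1 hb⟩

/-- Any two vertices of `T` reach each other within `T`. -/
def IsStrong (A : V → V → Prop) (T : Set V) : Prop := ∀ a ∈ T, ∀ b ∈ T, Reach A T a b

lemma isStrong_flip : IsStrong (flip A) T ↔ IsStrong A T := by
  simp only [IsStrong, reach_flip]
  tauto

/-- `x` lies in an initial strong component of the non-strong subdigraph induced on `T`. -/
def IsSource (A : V → V → Prop) (T : Set V) (x : V) : Prop :=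
  x ∈ T ∧ (∀ t ∈ T, Reach A T t x → Reach A T x t) ∧ ∃ t ∈ T, ¬ Reach A T t x

/-- If deleting `u` from a strong subdigraph leaves a non-strong one, each vertex of its initial
components is connected to `u` by a quasi-Hamiltonian path. -/
lemma IsSource.hasQHPath [Finite V] (hA : IsSMD A) (hx : IsSource A T x) (hu : u ∉ T)
    (hT : IsStrong A (insert u T)) :
    HasQHPath A (insert u T) x u := by
  obtain ⟨hxT, hsrc, y₀, hy₀T, hy₀⟩ := hx
  obtain ⟨X, hX⟩ : ∃ X : Set V, X = {t ∈ T | Reach A T t x} := ⟨_, rfl⟩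
  obtain ⟨Y, hY⟩ : ∃ Y : Set V, Y = {t ∈ T | ¬ Reach A T t x} := ⟨_, rfl⟩
  have hXY : ∀ s ∈ X, ∀ t ∈ Y, ¬ SameClass A s t → A s t := by
    subst hX hY
    intro s hs t ht hst
    refine (adj_of_not_sameClass hst).resolve_right fun h => ht.2 ?_
    exact (Reach.of_adj h ht.1 hs.1).trans hs.2
  have hdisj : ∀ s ∈ X, s ∉ insert u Y := by
    subst hX hY
    rintro s ⟨hs, hs'⟩ (rfl | h)
    · exact hu hs
    · exact h.2 hs'
  have hreachX : ∀ t ∈ X, Reach A X x t := by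
    have key : ∀ s, Reach A T x s → Reach A T s x → Reach A X x s := by
      intro s hs
      induction hs with
      | refl => exact fun _ => .refl
      | @tail c s _ hcs ih =>
        intro hsx
        have hc := (Reach.of_adj hcs.1 hcs.2.1 hcs.2.2).trans hsx
        refine (ih hc).trans (Reach.of_adj hcs.1 ?_ ?_)
        · exact hX ▸ ⟨hcs.2.1, hc⟩
        · exact hX ▸ ⟨hcs.2.2, hsx⟩
    intro t ht
    rw [hX] at ht
    exact key t (hsrc t ht.1 ht.2) ht.2
  have hreachY : ∀ t ∈ insert u Y, Reach A (insert u Y) t u := by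
    have key : ∀ s, Reach A (insert u T) s u → s ∈ insert u Y → Reach A (insert u Y) s u := by
      intro s hs
      induction hs using Relation.ReflTransGen.head_induction_on with
      | refl => exact fun _ => .refl
      | @head s c hsc _ ih =>
        rintro hsY
        rcases hsY with rfl | hsY
        · exact .refl
        · have hcY : c ∈ insert u Y := by
            rcases hsc.2.2 with rfl | hcT
            · exact Or.inl rfl
            · refine Or.inr ?_
              rw [hY] at hsY ⊢
              exact ⟨hcT, fun h => hsY.2 ((Reach.of_adj hsc.1 hsY.1 hcT).trans h)⟩
          exact (Reach.of_adj hsc.1 (Or.inr hsY) hcY).trans (ih hcY)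
    intro t ht
    refine key t (hT t ?_ u (Or.inl rfl)) ht
    rcases ht with rfl | ht
    · exact Or.inl rfl
    · exact Or.inr (hY ▸ ht : t ∈ {t ∈ T | ¬ Reach A T t x}).1
  have hxX : x ∈ X := hX ▸ ⟨hxT, .refl⟩
  have hcover : insert u T ⊆ X ∪ insert u Y := by
    subst hX hY
    rintro t (rfl | ht)
    · exact Or.inr (Or.inl rfl)
    · by_cases h : Reach A T t x
      · exact Or.inl ⟨ht, h⟩
      · exact Or.inr (Or.inr ⟨ht, h⟩)
  have hXS : ∀ t ∈ X, t ∈ insert u T := fun t ht =>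
    Or.inr (hX ▸ ht : t ∈ {t ∈ T | Reach A T t x}).1
  have hYS : ∀ t ∈ insert u Y, t ∈ insert u T := by
    rintro t (rfl | ht)
    · exact Or.inl rfl
    · exact Or.inr (hY ▸ ht : t ∈ {t ∈ T | ¬ Reach A T t x}).1
  have huY : u ∉ Y := fun h => hu (hY ▸ h : u ∈ {t ∈ T | ¬ Reach A T t x}).1
  have hy₀Y : y₀ ∈ Y := hY ▸ ⟨hy₀T, hy₀⟩
  obtain ⟨c, p, ⟨⟨hpne, hpnd, hpc, hpX⟩, hpx, hpl⟩, hpcov⟩ := exists_path_from hxX hreachX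
  obtain ⟨d, q, ⟨⟨hqne, hqnd, hqc, hqY⟩, hqd, hqu⟩, hqcov⟩ :=
    exists_path_to (S := insert u Y) (Or.inl rfl) hreachY
  have hcp : c ∈ p := List.mem_of_getLast? hpl
  have hpX' : IsPathFromTo A (insert u T) p x c :=
    ⟨⟨hpne, hpnd, hpc, fun t ht => hXS t (hpX t ht)⟩, hpx, hpl⟩
  have hmem : ∀ t ∈ insert u T, t ∈ covered A p ∨ t ∈ covered A q := fun t ht =>
    (hcover ht).imp (fun h => hpcov h) (fun h => hqcov h)
  obtain ⟨q, rfl⟩ : ∃ q', q = d :: q' := by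
    cases q with
    | nil => simp at hqd
    | cons e q => exact ⟨q, by simpa using hqd⟩
  have hq : q ≠ [] := by
    rintro rfl
    obtain rfl : d = u := by simpa using hqu
    have hall : ∀ t ∈ insert d Y, SameClass A d t := fun t ht => by
      obtain ⟨s, hs, hst⟩ := hqcov ht
      obtain rfl : s = d := by simpa using hs
      exact hst
    rcases Relation.ReflTransGen.cases_tail (hreachY y₀ (Or.inr hy₀Y)) with rfl | ⟨e, -, he⟩
    · exact huY hy₀Y
    · exact hA.not_sameClass' he.1 (hall _ he.2.1)
  obtain ⟨e, q, rfl⟩ := List.exists_cons_of_ne_nil hq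
  have hqu' : (e :: q).getLast? = some u := by simpa using hqu
  have hqc' := List.isChain_cons_cons.1 hqc
  have hu_mem : u ∈ e :: q := List.mem_of_getLast? hqu'
  have hdu : d ≠ u := by
    rintro rfl
    exact (List.nodup_cons.1 hqnd).1 hu_mem
  have hdY : d ∈ Y := (hqY d (by simp)).resolve_left hdu
  have hpq : ∀ s ∈ p, s ∉ d :: e :: q := fun s hs hs' => hdisj s (hpX s hs) (hqY s hs')
  by_cases hcd : SameClass A c d
  · have hdcov : ∀ {r : List V} {t : V}, c ∈ r ∨ d ∈ r → t ∈ covered A [d] → t ∈ covered A r := by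
      rintro r t hr ⟨s, hs, hst⟩
      obtain rfl : s = d := by simpa using hs
      rcases hr with hr | hr
      · exact ⟨c, hr, hcd.trans hA hst⟩
      · exact ⟨s, hr, hst⟩
    by_cases heY : e ∈ Y
    · have hce : A c e := hXY c (hpX _ hcp) e heY
        fun h => hA.not_sameClass hqc'.1 (hcd.symm.trans hA h)
      refine ⟨p ++ e :: q, hpX'.append ⟨⟨by simp, by grind, hqc'.2, fun t ht => hYS t (hqY t ?_)⟩,
        rfl, hqu'⟩ ?_ hce, fun t ht => ?_⟩
      · simp [ht]
      · exact fun s hs hs' => hpq s hs (by simp [hs'])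
      · rcases hmem t ht with h | ⟨s, hs, hst⟩
        · exact covered_mono (by simp) h
        · rcases List.mem_cons.1 hs with rfl | hs
          · exact hdcov (.inl (by simp [hcp])) ⟨s, by simp, hst⟩
          · exact ⟨s, by simp [hs], hst⟩
    · obtain rfl : e = u := (hqY e (by simp)).resolve_right heY
      obtain rfl : q = [] := by
        by_contra hne
        rw [List.getLast?_cons_of_ne_nil hne] at hqu'
        have := List.mem_of_getLast? hqu'
        grind
      have hdS : d ∈ insert e T := hYS d (.inr hdY)
      have heS : e ∈ insert e T := Or.inl rfl
      have hde : IsPathFromTo A (insert e T) [d, e] d e :=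
        (isPathFromTo_singleton heS).cons hdS (by simpa using hdu) hqc'.1
      obtain ⟨p, rfl⟩ : ∃ p', p = p' ++ [c] := List.getLast?_eq_some_iff.1 hpl
      rcases List.eq_nil_or_concat p with rfl | ⟨p, b, rfl⟩
      · obtain rfl : c = x := by simpa using hpx
        obtain ⟨r, hr⟩ := (hT c (.inr hxT) e heS).exists_path heS
        have hcr : c ∈ r := List.mem_of_head? hr.2.1
        have her : e ∈ r := List.mem_of_getLast? hr.2.2
        refine ⟨r, hr, fun t ht => ?_⟩
        rcases hmem t ht with h | ⟨s, hs, hst⟩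
        · exact covered_mono (by simpa using hcr) h
        · rcases List.mem_cons.1 hs with rfl | hs
          · exact hdcov (.inl hcr) ⟨s, by simp, hst⟩
          · exact ⟨s, by grind, hst⟩
      · have hbc : A b c := by
          have := (List.isChain_append.1 hpc).2.2
          simpa using this
        have hbd : A b d := hXY b (hpX b (by simp)) d hdY
          fun h => hA.not_sameClass hbc (h.trans hA hcd.symm)
        have hpb : IsPathFromTo A (insert e T) (p ++ [b]) x b := by
          refine ⟨⟨by simp, ?_, ?_, ?_⟩, ?_, ?_⟩
          · grind
          · change List.IsChain A (p ++ [b])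
            simpa using (List.isChain_append.1 hpc).1
          · grind
          · simpa using hpx
          · simp
        refine ⟨_, hpb.append hde (fun s hs => hpq s (by simp at hs ⊢; tauto)) hbd,
          fun t ht => ?_⟩
        rcases hmem t ht with ⟨s, hs, hst⟩ | h
        · by_cases hsc : s = c
          · exact ⟨d, by simp, hcd.symm.trans hA (hsc ▸ hst)⟩
          · exact ⟨s, by simp at hs ⊢; tauto, hst⟩
        · exact covered_mono (by simp) h
  · have hcd' : A c d := hXY c (hpX _ hcp) d hdY hcd
    refine ⟨p ++ d :: e :: q, hpX'.append ⟨⟨by simp, hqnd, hqc, fun t ht => hYS t (hqY t ht)⟩,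
        rfl, hqu⟩ hpq hcd', fun t ht => ?_⟩
    rcases hmem t ht with h | h
    · exact covered_mono (by simp) h
    · exact covered_mono (by simp) h

lemma exists_isSource [Finite V] (hT : ¬ IsStrong A T) : ∃ x, IsSource A T x := by
  have hne : T.Nonempty := by
    by_contra h
    exact hT fun a ha => absurd ⟨a, ha⟩ h
  obtain ⟨_, ⟨x, hx, rfl⟩, hmin⟩ := (wellFounded_lt (α := Set V)).has_min
    ((fun x => {t | Reach A T t x}) '' T) (hne.image _)
  have hsrc : ∀ t ∈ T, Reach A T t x → Reach A T x t := by
    intro t ht htx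
    by_contra hxt
    refine hmin _ ⟨t, ht, rfl⟩ ((Set.ssubset_iff_of_subset ?_).2 ⟨x, .refl, hxt⟩)
    exact fun s hs => Reach.trans hs htx
  refine ⟨x, hx, hsrc, ?_⟩
  by_contra! h
  exact hT fun a ha b hb => (h a ha).trans (hsrc b hb (h b hb))

lemma exists_adj_isSource [Finite V] (hT : ¬ IsStrong A T) (hu : u ∉ T)
    (hS : IsStrong A (insert u T)) : ∃ x, A u x ∧ IsSource A T x := by
  obtain ⟨x, hxT, hx, y, hyT, hy⟩ := exists_isSource hT
  obtain ⟨s, hs, t, ht, hsT, hst, -⟩ := (hS u (.inl rfl) x (.inr hxT)).exists_exit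
    (P := {t | t ∈ T ∧ Reach A T t x}ᶜ) (fun h => hu h.1) (fun h => h ⟨hxT, .refl⟩)
  obtain ⟨htT, htx⟩ : t ∈ T ∧ Reach A T t x := not_not.1 ht.2
  have hsu : s = u := by
    refine hsT.resolve_right fun hsT => hs ⟨hsT, (Reach.of_adj hst hsT htT).trans htx⟩
  refine ⟨t, hsu ▸ hst, htT, fun r hr hrt => htx.trans (hx r hr (hrt.trans htx)), y, hyT,
    fun h => hy (h.trans htx)⟩

lemma hasQHPath_of_not_isStrong_compl_pair [Finite V] (hA : IsSMD A) (hvw : v ≠ w)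
    (hv : IsStrong A {v}ᶜ) (hw : IsStrong A {w}ᶜ) (h : ¬ IsStrong A {v, w}ᶜ) :
    HasQHPath A Set.univ v w := by
  have hv' : insert w ({v, w} : Set V)ᶜ = {v}ᶜ := by ext t; simp; grind
  have hw' : insert v ({v, w} : Set V)ᶜ = {w}ᶜ := by ext t; simp; grind
  obtain ⟨x, hvx, hx⟩ := exists_adj_isSource h (by simp) (hw' ▸ hw)
  obtain ⟨p, hp, hcov⟩ := hx.hasQHPath hA (u := w) (by simp) (hv' ▸ hv)
  rw [hv'] at hp hcov
  refine ⟨v :: p, (hp.mono (Set.subset_univ _)).cons (Set.mem_univ _)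
    (fun h => hp.1.2.2.2 v h rfl) hvx, fun t _ => ?_⟩
  by_cases htv : t = v
  · exact mem_covered_of_mem (by simp [htv])
  · exact covered_mono (by simp) (hcov htv)

/-- If `v` is not initial without `u`, nor `u` without `v`, then both dominate twin vertices
without further in-neighbors. -/
lemma exists_twin_sources [Finite V] (hA : IsSMD A) (hD : IsStrong A Set.univ) (huv : u ≠ v)
    (hu : ¬ IsStrong A {u}ᶜ) (hv : ¬ IsStrong A {v}ᶜ) (hvu : ¬ IsSource A {u}ᶜ v)
    (huv' : ¬ IsSource A {v}ᶜ u) :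
    ∃ x y, A u x ∧ A v y ∧ SameClass A x y ∧ (∀ s, A s x → s = u) ∧ ∀ s, A s y → s = v := by
  have hins : ∀ u : V, insert u ({u} : Set V)ᶜ = Set.univ := fun u => by
    ext t; simp [em]
  obtain ⟨x, hux, hx⟩ := exists_adj_isSource hu (by simp) ((hins u).symm ▸ hD)
  obtain ⟨y, hvy, hy⟩ := exists_adj_isSource hv (by simp) ((hins v).symm ▸ hD)
  have equiv : ∀ {T : Set V} {x v : V}, IsSource A T x → v ∈ T → Reach A T v x →
      IsSource A T v := by
    rintro T x v ⟨hxT, hx, r, hrT, hr⟩ hvT hvx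
    exact ⟨hvT, fun t ht htv => hvx.trans (hx t ht (htv.trans hvx)), r, hrT,
      fun h => hr (h.trans hvx)⟩
  have hvX : ¬ Reach A {u}ᶜ v x := fun h => hvu (equiv hx huv.symm h)
  have huY : ¬ Reach A {v}ᶜ u y := fun h => huv' (equiv hy huv h)
  have hdisj : ∀ t, Reach A {u}ᶜ t x → Reach A {v}ᶜ t y → t ≠ v → False := by
    intro t htx hty htv
    have hyt : Reach A {v}ᶜ y t := hy.2.1 t htv hty
    have key : ∀ s, Reach A {v}ᶜ s t → Reach A {u}ᶜ s t := by
      intro s hs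
      induction hs using Relation.ReflTransGen.head_induction_on with
      | refl => exact .refl
      | @head s c hsc hct ih =>
        have avoid : ∀ r, Reach A {v}ᶜ r t → r ∈ ({u}ᶜ : Set V) := by
          rintro r hr rfl
          exact huY (hr.trans hty)
        exact (Reach.of_adj hsc.1 (avoid s (.head hsc hct)) (avoid c hct)).trans ih
    have hyx : Reach A {u}ᶜ y x := (key y hyt).trans htx
    have hyu : y ≠ u := by
      rintro rfl
      exact huY .refl
    exact hvX ((Reach.of_adj hvy huv.symm hyu).trans hyx)
  have hxv : x ≠ v := by
    rintro rfl
    exact hvX .refl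
  have hyu : y ≠ u := by
    rintro rfl
    exact huY .refl
  have hclass : ∀ s t, Reach A {u}ᶜ s x → Reach A {v}ᶜ t y → s ≠ u → t ≠ v →
      SameClass A s t := by
    intro s t hs ht hsu htv
    have hsv : s ≠ v := by
      rintro rfl
      exact hvX hs
    have htu : t ≠ u := by
      rintro rfl
      exact huY ht
    by_contra h
    rcases adj_of_not_sameClass h with h | h
    · exact hdisj s hs ((Reach.of_adj h hsv htv).trans ht) hsv
    · exact hdisj t ((Reach.of_adj h htu hsu).trans hs) ht htv
  have hxy := hclass x y .refl .refl hx.1 hy.1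
  refine ⟨x, y, hux, hvy, hxy, fun s hs => ?_, fun s hs => ?_⟩
  · by_contra hsu
    have := hclass s y (Reach.of_adj hs hsu hx.1) .refl hsu hy.1
    exact hA.not_sameClass hs (this.trans hA hxy.symm)
  · by_contra hsv
    have := hclass x s .refl (Reach.of_adj hs hsv hy.1) hx.1 hsv
    exact hA.not_sameClass' hs (hxy.symm.trans hA this)

lemma hasQHPath_of_not_isStrong_compl [Finite V] (hA : IsSMD A) (hD : IsStrong A Set.univ)
    (huv : u ≠ v) (hu : ¬ IsStrong A {u}ᶜ) (hv : ¬ IsStrong A {v}ᶜ) :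
    HasQHPath A Set.univ u v ∨ HasQHPath A Set.univ v u := by
  have hins : ∀ u : V, insert u ({u} : Set V)ᶜ = Set.univ := fun u => by
    ext t; simp [em]
  have src : ∀ {B : V → V → Prop} {u v : V}, IsSMD B → IsStrong B Set.univ →
      IsSource B {u}ᶜ v → HasQHPath B Set.univ v u := by
    intro B u v hB hDB h
    have := h.hasQHPath hB (u := u) (by simp) ((hins u).symm ▸ hDB)
    rwa [hins] at this
  have hD' := isStrong_flip.2 hD
  by_cases h₁ : IsSource A {u}ᶜ v
  · exact .inr (src hA hD h₁)
  by_cases h₂ : IsSource A {v}ᶜ u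
  · exact .inl (src hA hD h₂)
  by_cases h₃ : IsSource (flip A) {u}ᶜ v
  · exact .inl (hasQHPath_flip.1 (src hA.flip hD' h₃))
  by_cases h₄ : IsSource (flip A) {v}ᶜ u
  · exact .inr (hasQHPath_flip.1 (src hA.flip hD' h₄))
  left
  obtain ⟨x, x', hux, hvx', hxx', hx, -⟩ := exists_twin_sources hA hD huv hu hv h₁ h₂
  obtain ⟨t', t, htu, ht'v, htt', -, ht'⟩ := exists_twin_sources hA.flip hD' huv
    (mt isStrong_flip.1 hu) (mt isStrong_flip.1 hv) h₃ h₄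
  rw [sameClass_flip] at htt'
  simp only [flip] at htu ht'v ht'
  have hxout : ∀ s, s ≠ u → ¬ SameClass A x s → A x s := fun s hs h =>
    (adj_of_not_sameClass h).resolve_right fun h => hs (hx s h)
  have htin : ∀ s, s ≠ v → ¬ SameClass A s t → A s t := fun s hs h =>
    (adj_of_not_sameClass h).resolve_right fun h => hs (ht' s h)
  have hux' : ¬ SameClass A u x := hA.not_sameClass hux
  have hvx : ¬ SameClass A v x := fun h => hA.not_sameClass hvx' (h.trans hA hxx')
  have hvt : ¬ SameClass A t v := hA.not_sameClass ht'v
  have hut : ¬ SameClass A t u := fun h => hA.not_sameClass htu (htt'.trans hA h)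
  have ne : ∀ {a b : V}, ¬ SameClass A a b → a ≠ b := by
    rintro a b h rfl
    exact h (.refl A a)
  obtain ⟨R, hR⟩ : ∃ R : Set V,
      R = {s | s ≠ u ∧ s ≠ v ∧ ¬ SameClass A x s ∧ ¬ SameClass A s t} := ⟨_, rfl⟩
  have hxR : ∀ s ∈ R, A x s := by
    subst hR
    exact fun s hs => hxout s hs.1 hs.2.2.1
  obtain ⟨b, p, ⟨⟨hne, hnd, hc, hpR⟩, hpx, hpb⟩, hcov⟩ := exists_path_from (A := A) (x := x)
    (S := insert x R) (.inl rfl) fun s hs => by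
      rcases hs with rfl | hs
      · exact .refl
      · exact .of_adj (hxR s hs) (.inl rfl) (.inr hs)
  have hup : IsPathFromTo A Set.univ (u :: p) u b := by
    refine IsPathFromTo.cons (Set.mem_univ _) ⟨⟨hne, hnd, hc, by simp⟩, hpx, hpb⟩ ?_ hux
    intro h
    rcases hpR u h with h | h
    · exact ne hux' h
    · subst hR
      exact h.1 rfl
  have hvp : v ∉ u :: p := by
    intro h
    rcases List.mem_cons.1 h with h | h
    · exact huv h.symm
    rcases hpR v h with h | h
    · exact ne hvx h
    · subst hR
      exact h.2.1 rfl
  have hxp : x ∈ p := List.mem_of_head? hpx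
  by_cases hcase : SameClass A x t ∧ R = ∅
  · have hbx : b = x := by
      have := hpR b (List.mem_of_getLast? hpb)
      simpa [hcase.2] using this
    subst hbx
    refine ⟨u :: p ++ [v], hup.append (isPathFromTo_singleton (Set.mem_univ _)) (by grind)
      (hxout v huv.symm fun h => hvx h.symm), fun s _ => ?_⟩
    have hs : s ∉ R := by simp [hcase.2]
    rw [hR] at hs
    by_cases h₁ : SameClass A b s
    · exact ⟨b, by simp [hxp], h₁⟩
    by_cases h₂ : SameClass A s t
    · exact ⟨b, by simp [hxp], hcase.1.trans hA h₂.symm⟩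
    by_cases h₃ : s = u
    · exact mem_covered_of_mem (by simp [h₃])
    by_cases h₄ : s = v
    · exact mem_covered_of_mem (by simp [h₄])
    exact absurd ⟨h₃, h₄, h₁, h₂⟩ hs
  · have hbt : A b t := by
      rcases hpR b (List.mem_of_getLast? hpb) with rfl | hb
      · by_cases hbt : SameClass A b t
        · have hRne : R.Nonempty := by
            rw [Set.nonempty_iff_ne_empty]
            exact fun h => hcase ⟨hbt, h⟩
          obtain ⟨r, hr⟩ := hRne
          obtain ⟨s, hs, hsr⟩ := hcov (.inr hr)
          obtain rfl : s = b := by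
            cases p with
            | nil => simp at hs
            | cons a p =>
              obtain rfl : a = b := by simpa using hpx
              cases p with
              | nil => simpa using hs
              | cons c p =>
                have := List.mem_of_getLast? (by simpa using hpb : (c :: p).getLast? = some a)
                exact absurd this (List.nodup_cons.1 hnd).1
          subst hR
          exact absurd hsr hr.2.2.1
        · exact htin b (fun h => hvp (by simp [← h, hxp])) hbt
      · subst hR
        exact htin b hb.2.1 hb.2.2.2
    have htp : t ∉ u :: p := by
      intro h
      rcases List.mem_cons.1 h with h | h
      · exact ne hut h
      rcases hpR t h with h | h
      · subst h
        refine hcase ⟨.refl A _, ?_⟩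
        rw [Set.eq_empty_iff_forall_notMem]
        intro r hr
        have := ht' r (hxR r hr)
        subst hR
        exact hr.2.1 this
      · subst hR
        exact h.2.2.2 (.refl A t)
    have htv : IsPathFromTo A Set.univ [t, v] t v :=
      (isPathFromTo_singleton (Set.mem_univ _)).cons (Set.mem_univ _) (by simpa using ne hvt) ht'v
    refine ⟨u :: p ++ [t, v], hup.append htv (by grind) hbt, fun s _ => ?_⟩
    by_cases h₁ : SameClass A x s
    · exact ⟨x, by simp [hxp], h₁⟩
    by_cases h₂ : SameClass A s t
    · exact ⟨t, by simp, h₂.symm⟩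
    by_cases h₃ : s = u
    · exact mem_covered_of_mem (by simp [h₃])
    by_cases h₄ : s = v
    · exact mem_covered_of_mem (by simp [h₄])
    exact covered_mono (by intro; simp; tauto) (hcov (.inr (hR ▸ ⟨h₃, h₄, h₁, h₂⟩)))

/-- The vertices of `c` are distinct, and in cyclic order each dominates the next one
(a single vertex is allowed). -/
def IsCyc (A : V → V → Prop) (c : List V) : Prop :=
  c.Nodup ∧ ∀ c', c' ~r c → c'.IsChain A

lemma IsCyc.rotate {c c' : List V} (h : IsCyc A c) (hc : c' ~r c) : IsCyc A c' :=
  ⟨hc.nodup_iff.2 h.1, fun _ h' => h.2 _ (h'.trans hc)⟩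

lemma IsCyc.mk' {c : List V} (hnd : c.Nodup) (hc : c.IsChain A)
    (h : ∀ x ∈ c.getLast?, ∀ y ∈ c.head?, A x y) : IsCyc A c := by
  refine ⟨hnd, fun c' hc' => ?_⟩
  obtain ⟨n, rfl⟩ := hc'.symm
  rw [List.rotate_eq_drop_append_take_mod]
  rw [← List.take_append_drop (n % c.length) c] at hc h
  generalize c.take (n % c.length) = a at *
  generalize c.drop (n % c.length) = b at *
  rw [List.isChain_append] at hc ⊢
  refine ⟨hc.2.1, hc.1, fun x hx y hy => h x ?_ y ?_⟩
  · simp [List.getLast?_append, Option.mem_def.1 hx]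
  · simp [List.head?_append, Option.mem_def.1 hy]

lemma isCyc_flip_reverse {c : List V} : IsCyc (flip A) c.reverse ↔ IsCyc A c := by
  have key : ∀ {A : V → V → Prop} {c : List V}, IsCyc A c → IsCyc (flip A) c.reverse := by
    refine fun {A c} h => ⟨List.nodup_reverse.2 h.1, fun c' hc' => ?_⟩
    rw [← List.reverse_reverse c']
    exact List.isChain_reverse.2 (h.2 _ (by simpa using hc'.reverse))
  exact ⟨fun h => by simpa using key h, key⟩

lemma exists_rotation_concat {c : List V} {s : V} (hs : s ∈ c) : ∃ m, (m ++ [s]) ~r c := by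
  obtain ⟨a, b, rfl⟩ := List.mem_iff_append.1 hs
  refine ⟨b ++ a, ?_⟩
  simpa using List.isRotated_append (l := b) (l' := a ++ [s])

lemma exists_first_split {c : List V} {P : V → Prop} (h : ∃ s ∈ c, P s) :
    ∃ a s b, c = a ++ s :: b ∧ P s ∧ ∀ t ∈ a, ¬ P t := by
  induction c with
  | nil => simp at h
  | cons x c ih =>
    by_cases hx : P x
    · exact ⟨[], x, c, rfl, hx, by simp⟩
    · obtain ⟨a, s, b, rfl, hs, ha⟩ := ih (by simpa [hx] using h)
      exact ⟨x :: a, s, b, rfl, hs, by simpa [hx] using ha⟩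

lemma exists_last_split {c : List V} {P : V → Prop} (h : ∃ s ∈ c, P s) :
    ∃ a s b, c = a ++ s :: b ∧ P s ∧ ∀ t ∈ b, ¬ P t := by
  obtain ⟨a, s, b, hc, hs, ha⟩ := exists_first_split (c := c.reverse) (P := P) (by simpa using h)
  refine ⟨b.reverse, s, a.reverse, ?_, hs, by simpa using ha⟩
  rw [← List.reverse_reverse c, hc]
  simp

/-- Every vertex of a strong semicomplete multipartite digraph lies on a quasi-Hamiltonian
cycle. -/
lemma exists_isCyc [Finite V] (hu : u ∈ S) (hS : IsStrong A S) :
    ∃ c, IsCyc A c ∧ (∀ t ∈ c, t ∈ S) ∧ u ∈ c ∧ S ⊆ covered A c := by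
  obtain ⟨c, ⟨hc, hcS, huc⟩, hmax⟩ := exists_covered_maximal A
    (fun c => IsCyc A c ∧ (∀ t ∈ c, t ∈ S) ∧ u ∈ c)
    ⟨[u], ⟨by simp, fun c' h => by simp [List.isRotated_singleton_iff.1 h]⟩,
      by simpa using hu, by simp⟩
  refine ⟨c, hc, hcS, huc, fun z hz => ?_⟩
  by_contra hzc
  have hzc' : z ∉ c := fun h => hzc (mem_covered_of_mem h)
  have extend : ∀ (e l : List V) (x y : V), e ~r c → IsPathFromTo A (S \ {t | t ∈ c}) l x y →
      z ∈ l → (∀ s ∈ e.getLast?, A s x) → (∀ s ∈ e.head?, A y s) → False := by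
    rintro e l x y he ⟨⟨hlne, hlnd, hlc, hlS⟩, hlx, hly⟩ hzl hex hye
    have hmem : ∀ t, t ∈ e ↔ t ∈ c := fun t => he.mem_iff
    have hene : e ≠ [] := fun h => by simpa [h] using (hmem u).2 huc
    have hend : e.Nodup := (hc.rotate he).1
    refine hzc (hmax (e ++ l) ⟨IsCyc.mk' ?_ ?_ ?_, ?_, ?_⟩ ?_ z (by simp [hzl]))
    · refine List.nodup_append.2 ⟨hend, hlnd, ?_⟩
      rintro s hs _ ht rfl
      exact (hlS s ht).2 ((hmem s).1 hs)
    · refine List.isChain_append.2 ⟨hc.2 e he, hlc, fun s hs t ht => ?_⟩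
      obtain rfl : x = t := by simpa [hlx] using ht
      exact hex s hs
    · intro s hs t ht
      obtain rfl : y = s := by simpa [List.getLast?_append, hly] using hs
      rw [List.head?_append_of_ne_nil _ hene] at ht
      exact hye t ht
    · intro t ht
      rcases List.mem_append.1 ht with h | h
      · exact hcS t ((hmem t).1 h)
      · exact (hlS t h).1
    · simp [(hmem u).2 huc]
    · intro t ht
      simp [(hmem t).2 ht]
  have hzpath : IsPathFromTo A (S \ {t | t ∈ c}) [z] z z := isPathFromTo_singleton ⟨hz, hzc'⟩
  by_cases hin : ∃ s ∈ c, A s z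
  · by_cases hout : ∃ s ∈ c, A z s
    · obtain ⟨s, hs, hsz⟩ := hin
      obtain ⟨m, hm⟩ := exists_rotation_concat hs
      obtain ⟨a, t, b, hab, hzt, ha⟩ := exists_first_split (c := m ++ [s]) (P := A z)
        (by simpa only [hm.mem_iff] using hout)
      have hrot : (t :: b ++ a) ~r c := by
        refine List.IsRotated.trans ?_ hm
        rw [hab]
        exact List.isRotated_append
      refine extend _ _ z z hrot hzpath (by simp) (fun x hx => ?_) (by simpa using hzt)
      rcases List.eq_nil_or_concat a with rfl | ⟨a, x', rfl⟩
      · have : (t :: b).getLast? = some s := by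
          rw [← List.nil_append (t :: b), ← hab]
          simp
        obtain rfl : s = x := by simpa [this] using hx
        exact hsz
      · obtain rfl : x' = x := by simpa [List.getLast?_append, List.getLast?_cons] using hx
        have hxc : x' ∈ c := hm.mem_iff.1 (by simp [hab])
        exact (adj_of_notMem_covered hzc hxc).resolve_right (ha x' (by simp))
    · obtain ⟨s, hs, y, l, hl, hys⟩ := (hS z hz u hu).exists_entry_path (P := {t | t ∈ c})
        hzc' huc hz
      obtain ⟨a, b, hab⟩ := List.mem_iff_append.1 hs
      have hrot : (s :: b ++ a) ~r c := by
        rw [hab]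
        exact List.isRotated_append
      refine extend _ _ z y hrot hl (List.mem_of_head? hl.2.1) (fun x hx => ?_)
        (by simpa using hys)
      have hxc : x ∈ c := hrot.mem_iff.1 (List.mem_of_getLast? hx)
      exact (adj_of_notMem_covered hzc hxc).resolve_right fun h => hout ⟨x, hxc, h⟩
  · obtain ⟨s, hs, y, l, hl, hsy⟩ := (hS u hu z hz).exists_exit_path (P := {t | t ∈ c})
      huc hzc' hz
    obtain ⟨m, hm⟩ := exists_rotation_concat hs
    refine extend _ _ y z hm hl (List.mem_of_getLast? hl.2.2) (by simpa using hsy)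
      (fun x hx => ?_)
    have hxc : x ∈ c := hm.mem_iff.1 (List.mem_of_head? hx)
    exact (adj_of_notMem_covered hzc hxc).resolve_left fun h => hin ⟨x, hxc, h⟩

/-- A cycle avoiding `v` and `w` and meeting the color classes of all other vertices. -/
structure IsCycAround (A : V → V → Prop) (v w : V) (c : List V) : Prop where
  isCyc : IsCyc A c
  left_notMem : v ∉ c
  right_notMem : w ∉ c
  cover : ∀ t, t ≠ v → t ≠ w → t ∈ covered A c

namespace IsCycAround

variable {c : List V}

lemma symm (h : IsCycAround A v w c) : IsCycAround A w v c :=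
  ⟨h.1, h.3, h.2, fun t htw htv => h.4 t htv htw⟩

lemma rotate {c' : List V} (h : IsCycAround A v w c) (hc : c' ~r c) : IsCycAround A v w c' := by
  refine ⟨h.1.rotate hc, mt hc.mem_iff.1 h.2, mt hc.mem_iff.1 h.3, fun t htv htw => ?_⟩
  exact covered_mono (fun s hs => hc.mem_iff.2 hs) (h.4 t htv htw)

lemma flip_reverse (h : IsCycAround A v w c) : IsCycAround (flip A) v w c.reverse :=
  ⟨isCyc_flip_reverse.2 h.1, by simpa using h.2, by simpa using h.3,
    by simpa only [covered_flip_reverse] using h.4⟩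

/-- A path is quasi-Hamiltonian if it contains `v`, `w` and all vertices of the cycle outside the
color classes of `v` and `w`. -/
lemma hasQHPath (hA : IsSMD A) (h : IsCycAround A v w c) {p : List V}
    (hp : IsPathFromTo A Set.univ p a b) (hv : v ∈ p) (hw : w ∈ p)
    (hcp : ∀ s ∈ c, ¬ SameClass A v s → ¬ SameClass A w s → s ∈ p) :
    HasQHPath A Set.univ a b := by
  refine ⟨p, hp, fun t _ => ?_⟩
  by_cases htv : SameClass A v t
  · exact ⟨v, hv, htv⟩
  by_cases htw : SameClass A w t
  · exact ⟨w, hw, htw⟩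
  obtain ⟨s, hs, hst⟩ := h.4 t (fun h => htv (.inl h.symm)) (fun h => htw (.inl h.symm))
  exact ⟨s, hcp s hs (fun h => htv (h.trans hA hst)) fun h => htw (h.trans hA hst), hst⟩

/-- If `v` and `w` can be attached to the ends of an arc of the cycle whose remainder
only has colors of `v` and `w`, they are connected by a quasi-Hamiltonian path. -/
lemma hasQHPath_of_arc (hA : IsSMD A) (hvw : v ≠ w) {l r : List V} {x y : V}
    (h : IsCycAround A v w (l ++ r)) (hr : ∀ s ∈ r, ¬ SameClass A v s → SameClass A w s)
    (hy : l.head? = some y) (hx : l.getLast? = some x) (hvy : A v y) (hxw : A x w) :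
    HasQHPath A Set.univ v w := by
  have hl : IsPathFromTo A Set.univ l y x :=
    ⟨⟨by rintro rfl; simp at hy, (List.nodup_append.1 h.1.1).1,
      (List.isChain_append.1 (h.1.2 _ (.refl _))).1, by simp⟩, hy, hx⟩
  have hv : v ∉ l := fun hv => h.2 (by simp [hv])
  have hw : w ∉ l := fun hw => h.3 (by simp [hw])
  refine h.hasQHPath hA (p := v :: l ++ [w]) ?_ (by simp) (by simp) ?_
  · exact (hl.cons (Set.mem_univ _) hv hvy).append (isPathFromTo_singleton (Set.mem_univ _))
      (by grind) hxw
  · intro s hs hvs hws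
    rcases List.mem_append.1 hs with hs | hs
    · simp [hs]
    · exact absurd (hr s hs hvs) hws

lemma hasQHPath_of_dominated (hA : IsSMD A) (hD : IsStrong A Set.univ) (hvw : v ≠ w)
    (h : IsCycAround A v w c) {y : V} (hyc : y ∈ c) (hvy : A v y) (hwy : A w y) :
    HasQHPath A Set.univ v w ∨ HasQHPath A Set.univ w v := by
  by_contra! hcon
  have hdom : ∀ s ∈ c, ¬ SameClass A v s → ¬ SameClass A w s → A v s ∧ A w s := by
    intro s hs hvs hws
    by_contra hP
    obtain ⟨m, hm⟩ := exists_rotation_concat hyc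
    have hsm : s ∈ m := by
      have := hm.mem_iff.2 hs
      rw [List.mem_append, List.mem_singleton] at this
      refine this.resolve_right ?_
      rintro rfl
      exact hP ⟨hvy, hwy⟩
    obtain ⟨a, m, rfl⟩ := List.mem_iff_append.1 hsm
    obtain ⟨r, y', b, hb, hy', hr⟩ := exists_first_split (c := m ++ [y])
      (P := fun s => A v s ∧ A w s) ⟨y, by simp, hvy, hwy⟩
    obtain ⟨a', x, r', hx, hx', hr'⟩ := exists_last_split (c := s :: r)
      (P := fun s => ¬ SameClass A v s ∧ ¬ SameClass A w s) ⟨s, by simp, hvs, hws⟩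
    have hrot : ((y' :: b ++ a ++ a' ++ [x]) ++ r') ~r c := by
      refine List.IsRotated.trans ?_ hm
      have e : a ++ s :: m ++ [y] = (a ++ (a' ++ x :: r')) ++ (y' :: b) := by
        rw [← hx]
        simp [hb]
      rw [e]
      simpa using List.isRotated_append (l := y' :: b) (l' := a ++ (a' ++ x :: r'))
    have hc' := h.rotate hrot
    have hxP : ¬ (A v x ∧ A w x) := by
      have : x ∈ s :: r := by simp [hx]
      rcases List.mem_cons.1 this with rfl | hxr
      · exact hP
      · exact hr x hxr
    have hlast : (y' :: b ++ a ++ a' ++ [x]).getLast? = some x := by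
      rw [List.getLast?_append]
      rfl
    have h₁ : ¬ A x w := fun hxw => hcon.1 (hc'.hasQHPath_of_arc hA hvw
      (fun t ht htv => by_contra fun htw => hr' t ht ⟨htv, htw⟩) (y := y') (x := x) (by simp)
      hlast hy'.1 hxw)
    have h₂ : ¬ A x v := fun hxv => hcon.2 (hc'.symm.hasQHPath_of_arc hA hvw.symm
      (fun t ht htv => by_contra fun htw => hr' t ht ⟨htw, htv⟩) (y := y') (x := x) (by simp)
      hlast hy'.2 hxv)
    exact hxP ⟨(adj_of_not_sameClass hx'.1).resolve_right h₂,
      (adj_of_not_sameClass hx'.2).resolve_right h₁⟩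
  obtain ⟨t, ht, z, hz⟩ : ∃ t ∈ ({v, w} : Set V), ∃ z q s, s ∈ c ∧
      IsPathFromTo A Set.univ q z t ∧ A s z ∧ ∀ x ∈ q, x ∉ c ∧ (x = t ∨ x ∉ ({v, w} : Set V)) := by
    have hyvw : y ∉ ({v, w} : Set V) := by
      rintro (rfl | rfl)
      exacts [h.2 hyc, h.3 hyc]
    obtain ⟨t, ht, e, q, hq, het⟩ := (hD y (Set.mem_univ _) v (Set.mem_univ _)).exists_entry_path
      hyvw (by simp) (Set.mem_univ _)
    have htc : t ∉ c := by
      rcases ht with rfl | rfl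
      exacts [h.2, h.3]
    refine ⟨t, ht, ?_⟩
    by_cases hec : e ∈ c
    · exact ⟨t, [t], e, hec, isPathFromTo_singleton (Set.mem_univ _), het, by simpa using htc⟩
    · obtain ⟨s, hs, z, l, hl, hsz⟩ := hq.reach.exists_exit_path (P := {x | x ∈ c}) hyc hec
        (hq.1.2.2.2 e (List.mem_of_getLast? hq.2.2))
      have hlc : ∀ x ∈ l, x ∉ c ∧ x ∉ ({v, w} : Set V) := fun x hx =>
        ⟨(hl.1.2.2.2 x hx).2, (hl.1.2.2.2 x hx).1.2⟩
      refine ⟨z, l ++ [t], s, hs, (hl.mono (Set.subset_univ _)).append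
        (isPathFromTo_singleton (Set.mem_univ _)) ?_ het, hsz, ?_⟩
      · intro x hx hxt
        obtain rfl : x = t := by simpa using hxt
        exact (hlc x hx).2 ht
      · intro x hx
        rcases List.mem_append.1 hx with hx | hx
        · exact ⟨(hlc x hx).1, .inr (hlc x hx).2⟩
        · obtain rfl : x = t := by simpa using hx
          exact ⟨htc, .inl rfl⟩
  obtain ⟨q, s, hsc, hq, hsz, hqc⟩ := hz
  obtain ⟨m, hm⟩ := exists_rotation_concat hsc
  obtain ⟨r, x, b, hb, hx, hr⟩ := exists_first_split (c := m ++ [s])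
    (P := fun s => ¬ SameClass A v s ∧ ¬ SameClass A w s)
    ⟨y, hm.mem_iff.2 hyc, hA.not_sameClass hvy, hA.not_sameClass hwy⟩
  have hcm := h.rotate hm
  rw [hb] at hcm hm
  have hxs : IsPathFromTo A Set.univ (x :: b) x s := by
    refine ⟨⟨by simp, (List.nodup_append.1 hcm.1.1).2.1,
      (List.isChain_append.1 (hcm.1.2 _ (.refl _))).2.1, by simp⟩, rfl, ?_⟩
    have : (r ++ x :: b).getLast? = some s := by rw [← hb]; simp
    simpa [List.getLast?_append, List.getLast?_cons] using this
  have hxb : ∀ t ∈ x :: b, t ∈ c := fun t ht => hm.mem_iff.1 (by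
    rw [List.mem_append]
    exact .inr ht)
  have hxq := hxs.append hq (fun t ht htq => (hqc t htq).1 (hxb t ht)) hsz
  have hxdom := hdom x (hxb x (by simp)) hx.1 hx.2
  have hcover : ∀ s ∈ r ++ x :: b, ¬ SameClass A v s → ¬ SameClass A w s → s ∈ x :: b := by
    intro s hs hvs hws
    exact (List.mem_append.1 hs).resolve_left fun h => hr s h ⟨hvs, hws⟩
  have htq : t ∈ q := List.mem_of_getLast? hq.2.2
  have final : ∀ t', t' ∈ ({v, w} : Set V) → t' ≠ t → t' ∉ x :: b ++ q := by
    intro t' ht' hne hmem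
    rcases List.mem_append.1 hmem with h' | h'
    · rcases ht' with rfl | rfl
      exacts [h.2 (hxb _ h'), h.3 (hxb _ h')]
    · exact (hqc t' h').2.elim hne fun h => h ht'
  rcases ht with rfl | rfl
  · refine hcon.2 (hcm.hasQHPath hA (hxq.cons (Set.mem_univ w)
      (final w (by simp) hvw.symm) hxdom.2) (by simp [htq]) (by simp) fun s hs hvs hws => ?_)
    have := hcover s hs hvs hws
    rw [List.mem_cons, List.mem_append]
    exact .inr (.inl this)
  · refine hcon.1 (hcm.hasQHPath hA (hxq.cons (Set.mem_univ v)
      (final v (by simp) hvw) hxdom.1) (by simp) (by simp [htq]) fun s hs hvs hws => ?_)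
    have := hcover s hs hvs hws
    rw [List.mem_cons, List.mem_append]
    exact .inr (.inl this)

/-- The first vertex `y` of the cycle, among those adjacent to both `v` and `w`, is dominated by `v`
and dominates `w`. -/
lemma hasQHPath_of_first (hA : IsSMD A) (hvw : v ≠ w) {r m : List V} {y : V}
    (h : IsCycAround A v w (r ++ y :: m))
    (hr : ∀ s ∈ r, ¬ (¬ SameClass A v s ∧ ¬ SameClass A w s))
    (hu : (y :: m).getLast? = some u) (hvy : A v y) (hyw : A y w)
    (hin : ∀ s ∈ r ++ y :: m, ¬ (A s v ∧ A s w)) (hnot : ¬ HasQHPath A Set.univ v w) :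
    HasQHPath A Set.univ v u := by
  have hv := h.2
  have hw := h.3
  have hwone : IsPathFromTo A Set.univ [w] w w := isPathFromTo_singleton (Set.mem_univ _)
  by_cases hm : ∃ s ∈ m, ¬ SameClass A v s ∧ ¬ SameClass A w s
  · obtain ⟨r', z, b, rfl, ⟨hvz, hwz⟩, hr'⟩ := exists_first_split hm
    have hrot : ((z :: b ++ r ++ [y]) ++ r') ~r (r ++ y :: (r' ++ z :: b)) := by
      simpa using List.isRotated_append (l := z :: b) (l' := r ++ y :: r')
    have hlast : (z :: b ++ r ++ [y]).getLast? = some y := by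
      rw [List.getLast?_append]
      rfl
    have hAvz : ¬ A v z := fun hAvz => hnot ((h.rotate hrot).hasQHPath_of_arc hA hvw
      (fun s hs hvs => by_contra fun hws => hr' s hs ⟨hvs, hws⟩) (y := z) (x := y) (by simp)
      hlast hAvz hyw)
    have hAwz : A w z := (adj_of_not_sameClass hwz).resolve_right fun hzw =>
      hin z (by simp) ⟨(adj_of_not_sameClass hvz).resolve_left hAvz, hzw⟩
    have hb : IsPathFromTo A Set.univ (z :: b) z u := by
      refine ⟨⟨by simp, ?_, ?_, by simp⟩, rfl, ?_⟩
      · have := h.1.1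
        grind
      · have := (List.isChain_append.1 (h.1.2 _ (.refl _))).2.1
        rw [← List.cons_append] at this
        exact (List.isChain_append.1 this).2.1
      · simpa [List.getLast?_cons, List.getLast?_append] using hu
    have hnd := h.1.1
    refine h.hasQHPath hA (p := v :: y :: w :: z :: b)
      (((hb.cons (Set.mem_univ w) ?_ hAwz).cons (Set.mem_univ y) ?_ hyw).cons
        (Set.mem_univ v) ?_ hvy) (by simp) (by simp) ?_
    · grind
    · grind
    · grind
    · intro s hs hvs hws
      have := hr s
      have := hr' s
      grind
  · refine absurd (h.hasQHPath hA (p := [v, y, w])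
      ((hwone.cons (Set.mem_univ y) ?_ hyw).cons (Set.mem_univ v) ?_ hvy) (by simp) (by simp) ?_)
      hnot
    · grind
    · grind
    · intro s hs hvs hws
      have := hr s
      grind

end IsCycAround

lemma hasQHPath_of_isStrong_compl_pair [Finite V] (hA : IsSMD A) (hD : IsStrong A Set.univ)
    (hS : IsStrong A {v, w}ᶜ) (huv : u ≠ v) (huw : u ≠ w) (hvw : v ≠ w) :
    HasQHPath A Set.univ v w ∨ HasQHPath A Set.univ w v ∨ HasQHPath A Set.univ v u ∨
      HasQHPath A Set.univ w u := by
  by_contra! hcon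
  obtain ⟨hnvw, hnwv, hnvu, hnwu⟩ := hcon
  obtain ⟨c, hc, hcS, huc, hcov⟩ := exists_isCyc (u := u) (by simp [huv, huw]) hS
  obtain ⟨m, hm⟩ := exists_rotation_concat huc
  have h : IsCycAround A v w (m ++ [u]) := by
    refine IsCycAround.rotate ⟨hc, fun h => ?_, fun h => ?_, fun t htv htw => ?_⟩ hm
    · simpa using hcS v h
    · simpa using hcS w h
    · exact hcov (by simp [htv, htw])
  have hout : ∀ s ∈ m ++ [u], ¬ (A v s ∧ A w s) := fun s hs hvws =>
    (h.hasQHPath_of_dominated hA hD hvw hs hvws.1 hvws.2).elim hnvw hnwv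
  have hin : ∀ s ∈ m ++ [u], ¬ (A s v ∧ A s w) := fun s hs hvws =>
    (h.flip_reverse.hasQHPath_of_dominated hA.flip (isStrong_flip.2 hD) hvw
      (List.mem_reverse.2 hs) hvws.1 hvws.2).elim
      (fun h => hnwv (hasQHPath_flip.1 h)) (fun h => hnvw (hasQHPath_flip.1 h))
  by_cases hfree : ∃ s ∈ m ++ [u], ¬ SameClass A v s ∧ ¬ SameClass A w s
  · obtain ⟨r, y, b, hb, ⟨hvy, hwy⟩, hr⟩ := exists_first_split hfree
    have hlast : (y :: b).getLast? = some u := by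
      have : (r ++ y :: b).getLast? = some u := by rw [← hb]; simp
      simpa [List.getLast?_append, List.getLast?_cons] using this
    rw [hb] at h hin hout
    have hymem : y ∈ r ++ y :: b := by simp
    rcases adj_of_not_sameClass hvy with hAvy | hAyv
    · exact hnvu (h.hasQHPath_of_first hA hvw hr hlast hAvy
        ((adj_of_not_sameClass hwy).resolve_left fun h => hout y hymem ⟨hAvy, h⟩) hin hnvw)
    · exact hnwu (h.symm.hasQHPath_of_first hA hvw.symm (fun s hs h => hr s hs h.symm) hlast
        ((adj_of_not_sameClass hwy).resolve_right fun h => hin y hymem ⟨hAyv, h⟩) hAyv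
        (fun s hs h => hin s hs h.symm) hnwv)
  · obtain ⟨p, hp⟩ := (hD v (Set.mem_univ _) w (Set.mem_univ _)).exists_path (Set.mem_univ _)
    exact hnvw (h.hasQHPath hA hp (List.mem_of_head? hp.2.1) (List.mem_of_getLast? hp.2.2)
      fun s hs hvs hws => absurd ⟨s, hs, hvs, hws⟩ hfree)

lemma hasQHPath_of_isStrong_compl [Finite V] (hA : IsSMD A) (hD : IsStrong A Set.univ)
    (hv : IsStrong A {v}ᶜ) (hw : IsStrong A {w}ᶜ) (huv : u ≠ v) (huw : u ≠ w) (hvw : v ≠ w) :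
    HasQHPath A Set.univ v w ∨ HasQHPath A Set.univ w v ∨ HasQHPath A Set.univ v u ∨
      HasQHPath A Set.univ w u := by
  by_cases hS : IsStrong A {v, w}ᶜ
  · exact hasQHPath_of_isStrong_compl_pair hA hD hS huv huw hvw
  · exact .inl (hasQHPath_of_not_isStrong_compl_pair hA hvw hv hw hS)

end QuasiHamiltonian

/-- For any three distinct vertices `u, v, w` of a strong SMD there
is a quasi-Hamiltonian path connecting two of them. -/
theorem stmt_16 {V : Type*} [Fintype V] (A : V → V → Prop) (hSMD : IsSMD A)
    (hstrong : StrongOn A (Set.univ : Set V))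
    (u v w : V) (huv : u ≠ v) (huw : u ≠ w) (hvw : v ≠ w) :
    ∃ a b : V, a ∈ ({u, v, w} : Set V) ∧ b ∈ ({u, v, w} : Set V) ∧ a ≠ b ∧
      ∃ p : List V, IsPathFromTo A Set.univ p a b ∧
        ∀ t : V, ∃ s ∈ p, SameClass A s t := by
  have hD : IsStrong A Set.univ := by
    intro x hx y hy
    by_cases hxy : x = y
    · rw [hxy]
      exact .refl
    · obtain ⟨p, hp⟩ := hstrong x hx y hy hxy
      exact hp.reach
  suffices h : ∃ a b : V, a ∈ ({u, v, w} : Set V) ∧ b ∈ ({u, v, w} : Set V) ∧ a ≠ b ∧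
      HasQHPath A Set.univ a b by
    obtain ⟨a, b, ha, hb, hab, p, hp, hcov⟩ := h
    exact ⟨a, b, ha, hb, hab, p, hp, fun t => hcov (Set.mem_univ t)⟩
  have hu' : u ∈ ({u, v, w} : Set V) := by simp
  have hv' : v ∈ ({u, v, w} : Set V) := by simp
  have hw' : w ∈ ({u, v, w} : Set V) := by simp
  by_cases hu : IsStrong A {u}ᶜ <;> by_cases hv : IsStrong A {v}ᶜ
  · have := hasQHPath_of_isStrong_compl hSMD hD hu hv huw.symm hvw.symm huv
    grind
  · by_cases hw : IsStrong A {w}ᶜ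
    · have := hasQHPath_of_isStrong_compl hSMD hD hu hw huv.symm hvw huw
      grind
    · have := hasQHPath_of_not_isStrong_compl hSMD hD hvw hv hw
      grind
  · by_cases hw : IsStrong A {w}ᶜ
    · have := hasQHPath_of_isStrong_compl hSMD hD hv hw huv huw hvw
      grind
    · have := hasQHPath_of_not_isStrong_compl hSMD hD huw hu hw
      grind
  · have := hasQHPath_of_not_isStrong_compl hSMD hD huv hu hv
    grind
end
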